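/- arXiv:1702.03270 — 3 statements merged into one kernel-verified Lean document; each statement's English description precedes it below -/
import Mathlib

section
/- Let R be a commutative noetherian ring of finite Krull dimension and let W be any subset of Spec(R). Let M be the R-module ∏_{p ∈ W} Λ^p(R_p), the product over all p ∈ W of the pR_p-adic completions of the localizations R_p. Then for every prime ideal q of R, there exists i ≥ 0 with Ext^i_R(κ(q), M) ≠ 0 if and only if q ∈ W; that is, the cosupport of M is exactly W. -/
open CategoryTheory Opposite

universe u

/-- The cosupport of an `R`-module `M`, as a subset of `Spec R`: the primes `q` such
that `Ext^i_R(κ(q), M) ≠ 0` for some `i`, where `κ(q)` is the residue field of the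
localization `R_q`, regarded as an `R`-module. -/
noncomputable def moduleCosupport (R : Type u) [CommRing R] (M : Type u)
    [AddCommGroup M] [Module R M] : Set (PrimeSpectrum R) :=
  { q | ∃ i : ℕ, Nontrivial (((Ext R (ModuleCat.{u} R) i).obj
      (op (ModuleCat.of R (IsLocalRing.ResidueField (Localization.AtPrime q.asIdeal))))).obj
      (ModuleCat.of R M)) }

universe v

section

open Limits

variable {C : Type u} [Category.{v} C] [Abelian C]

/-- The complex `Hom(P, N)` is exact, spelled out on elements. -/
def HomAcyclic (P : ChainComplex C ℕ) (N : C) : Prop :=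
  ∀ (i : ℕ) (f : P.X i ⟶ N), P.d (i + 1) i ≫ f = 0 →
    ∃ g : P.X (i - 1) ⟶ N, P.d i (i - 1) ≫ g = f

namespace HomAcyclic

variable {P : ChainComplex C ℕ}

lemma of_retract {N N' : C} (s : N' ⟶ N) (r : N ⟶ N') (hsr : s ≫ r = 𝟙 N')
    (h : HomAcyclic P N) : HomAcyclic P N' := by
  intro i f hf
  obtain ⟨g, hg⟩ := h i (f ≫ s) (by rw [← Category.assoc, hf, zero_comp])
  exact ⟨g ≫ r, by rw [← Category.assoc, hg, Category.assoc, hsr, Category.comp_id]⟩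

lemma X₁_of_shortExact {S : ShortComplex C} (hS : S.ShortExact)
    [∀ i, Projective (P.X i)] (h₂ : HomAcyclic P S.X₂) (h₃ : HomAcyclic P S.X₃) :
    HomAcyclic P S.X₁ := by
  have := hS.mono_f
  have := hS.epi_g
  intro i f hf
  obtain ⟨g, hg⟩ := h₂ i (f ≫ S.f) (by rw [← Category.assoc, hf, zero_comp])
  cases i with
  | zero =>
    refine ⟨0, ?_⟩
    rw [P.shape _ _ (by simp), zero_comp] at hg
    rw [comp_zero]
    exact (zero_of_comp_mono S.f hg.symm).symm
  | succ i =>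
    change P.X i ⟶ S.X₂ at g
    change P.d (i + 1) i ≫ g = f ≫ S.f at hg
    obtain ⟨k, hk⟩ := h₃ i (g ≫ S.g) (by
      rw [← Category.assoc, hg, Category.assoc, S.zero, comp_zero])
    let k' := Projective.factorThru k S.g
    have hk' : k' ≫ S.g = k := Projective.factorThru_comp k S.g
    have hz : (g - P.d i (i - 1) ≫ k') ≫ S.g = 0 := by
      rw [Preadditive.sub_comp, Category.assoc, hk', hk]
      exact sub_self _
    refine ⟨hS.exact.lift _ hz, ?_⟩
    rw [← cancel_mono S.f, Category.assoc, ShortComplex.Exact.lift_f, ← hg]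
    change P.d (i + 1) i ≫ _ = _
    simp [Preadditive.comp_sub]

lemma X₃_of_shortExact {S : ShortComplex C} (hS : S.ShortExact)
    [∀ i, Projective (P.X i)] (h₁ : HomAcyclic P S.X₁) (h₂ : HomAcyclic P S.X₂) :
    HomAcyclic P S.X₃ := by
  have := hS.mono_f
  have := hS.epi_g
  intro i f hf
  let f' := Projective.factorThru f S.g
  have hf' : f' ≫ S.g = f := Projective.factorThru_comp f S.g
  have hz : (P.d (i + 1) i ≫ f') ≫ S.g = 0 := by rw [Category.assoc, hf', hf]
  obtain ⟨g, hg⟩ := h₁ (i + 1) (hS.exact.lift _ hz) (by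
    rw [← cancel_mono S.f, Category.assoc, ShortComplex.Exact.lift_f]
    simp)
  change P.X i ⟶ S.X₁ at g
  obtain ⟨g₂, hg₂⟩ := h₂ i (f' - g ≫ S.f) (by
    have : P.d (i + 1) i ≫ g = hS.exact.lift _ hz := hg
    rw [Preadditive.comp_sub, ← Category.assoc, this, ShortComplex.Exact.lift_f, sub_self])
  refine ⟨g₂ ≫ S.g, ?_⟩
  rw [← Category.assoc, hg₂, Preadditive.sub_comp, hf', Category.assoc, S.zero, comp_zero, sub_zero]

lemma exists_of_homotopy_zero {φ : P ⟶ P} (h : Homotopy φ 0) {N : C} {i : ℕ} (f : P.X i ⟶ N)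
    (hf : P.d (i + 1) i ≫ f = 0) :
    ∃ g : P.X (i - 1) ⟶ N, P.d i (i - 1) ≫ g = φ.f i ≫ f := by
  have hc := h.comm i
  have hp : prevD i h.hom ≫ f = 0 := by
    rw [prevD_eq h.hom (show (ComplexShape.down ℕ).Rel (i + 1) i from rfl), Category.assoc, hf,
      comp_zero]
  refine ⟨h.hom (i - 1) i ≫ f, ?_⟩
  rw [hc, Preadditive.add_comp, Preadditive.add_comp, hp]
  cases i with
  | zero => simp
  | succ i =>
    rw [dNext_eq h.hom (show (ComplexShape.down ℕ).Rel (i + 1) i from rfl)]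
    simp

variable {R : Type*} [CommRing R] [Linear R C]

lemma of_smul_eq_zero_of_isIso {K N : C} (Q : ProjectiveResolution K) (r : R)
    (hK : r • 𝟙 K = 0) (hN : IsIso (r • 𝟙 N)) : HomAcyclic Q.complex N := by
  have h : Homotopy (r • 𝟙 Q.complex) 0 :=
    ProjectiveResolution.liftHomotopyZero (P := Q) (Q := Q) _ (by
      rw [Linear.smul_comp, Category.id_comp]
      refine HomologicalComplex.to_single_hom_ext ?_
      let p : Q.complex.X 0 ⟶ K := Q.π.f 0
      have : p ≫ (r • 𝟙 K) = 0 := by rw [hK, comp_zero]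
      rw [Linear.comp_smul, Category.comp_id] at this
      exact this)
  intro i f hf
  obtain ⟨g, hg⟩ := exists_of_homotopy_zero h f hf
  refine ⟨g ≫ inv (r • 𝟙 N), ?_⟩
  rw [← Category.assoc, hg, IsIso.comp_inv_eq]
  simp

lemma of_isIso_of_smul_eq_zero {K N : C} (Q : ProjectiveResolution K) (r : R)
    (hK : IsIso (r • 𝟙 K)) (hN : r • 𝟙 N = 0) : HomAcyclic Q.complex N := by
  let U : Q.complex ⟶ Q.complex := ProjectiveResolution.lift (inv (r • 𝟙 K)) Q Q
  have hU : U ≫ Q.π = Q.π ≫ (ChainComplex.single₀ C).map (inv (r • 𝟙 K)) :=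
    ProjectiveResolution.lift_commutes _ _ _
  have h : Homotopy (r • U - 𝟙 Q.complex) 0 :=
    ProjectiveResolution.liftHomotopyZero (P := Q) (Q := Q) _ (by
      rw [Preadditive.sub_comp, Linear.smul_comp, hU, Category.id_comp, sub_eq_zero]
      refine HomologicalComplex.to_single_hom_ext ?_
      let p : Q.complex.X 0 ⟶ K := Q.π.f 0
      have : p ≫ (inv (r • 𝟙 K) ≫ (r • 𝟙 K)) = p := by
        rw [IsIso.inv_hom_id, Category.comp_id]
      rw [Linear.comp_smul, Category.comp_id, Linear.comp_smul] at this
      change r • (p ≫ ((ChainComplex.single₀ C).map (inv (r • 𝟙 K))).f 0) = p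
      rw [ChainComplex.single₀_map_f_zero]
      exact this)
  intro i f hf
  obtain ⟨g, hg⟩ := exists_of_homotopy_zero h f hf
  refine ⟨-g, ?_⟩
  have : r • f = 0 := by rw [← Category.comp_id f, ← Linear.comp_smul, hN, comp_zero]
  rw [Preadditive.comp_neg, hg]
  simp [this, ← Linear.comp_smul]

lemma comp_eq_zero {K N : C} (Q : ProjectiveResolution K) (h : HomAcyclic Q.complex N) (f : K ⟶ N) :
    f = 0 := by
  let p : Q.complex.X 0 ⟶ K := Q.π.f 0
  have hp : Epi p := inferInstanceAs (Epi (Q.π.f 0))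
  obtain ⟨g, hg⟩ := h 0 (p ≫ f) (by
    rw [← Category.assoc]
    exact (congrArg (· ≫ f) Q.complex_d_comp_π_f_zero).trans zero_comp)
  rw [Q.complex.shape _ _ (by simp), zero_comp] at hg
  exact zero_of_epi_comp p hg.symm
end HomAcyclic

lemma homAcyclic_iff_ext {C : Type u} [Category.{v} C] [Abelian C] [EnoughProjectives C]
    (R : Type*) [CommRing R] [Linear R C] {K : C} (Q : ProjectiveResolution K) (N : C) :
    HomAcyclic Q.complex N ↔ ∀ i : ℕ, Subsingleton (((Ext R C i).obj (op K)).obj N) := by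
  refine forall_congr' fun i => ?_
  have e := (Q.isoExt (R := R) i N).toLinearEquiv.toEquiv
  rw [e.subsingleton_congr, ← ModuleCat.isZero_iff_subsingleton,
    ← HomologicalComplex.exactAt_iff_isZero_homology,
    HomologicalComplex.exactAt_iff' _ (i - 1) i (i + 1) (by cases i <;> simp) (by simp),
    ShortComplex.moduleCat_exact_iff]
  rfl

namespace HomAcyclic

variable {R : Type u} [CommRing R] {P : ChainComplex (ModuleCat.{u} R) ℕ}

lemma of_linearEquiv {N N' : Type u} [AddCommGroup N] [Module R N] [AddCommGroup N'] [Module R N']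
    (e : N ≃ₗ[R] N') (h : HomAcyclic P (ModuleCat.of R N)) : HomAcyclic P (ModuleCat.of R N') :=
  h.of_retract e.toModuleIso.inv e.toModuleIso.hom e.toModuleIso.inv_hom_id

lemma pi {ι : Type u} (N : ι → Type u) [∀ i, AddCommGroup (N i)] [∀ i, Module R (N i)]
    (h : ∀ i, HomAcyclic P (ModuleCat.of R (N i))) :
    HomAcyclic P (ModuleCat.of R (∀ i, N i)) := by
  intro i f hf
  have hex : ∀ a, ∃ g : P.X (i - 1) ⟶ ModuleCat.of R (N a),
      P.d i (i - 1) ≫ g = f ≫ ModuleCat.ofHom (LinearMap.proj a) := fun a =>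
    h a i (f ≫ ModuleCat.ofHom (LinearMap.proj a)) (by rw [← Category.assoc, hf, zero_comp])
  choose g hg using hex
  refine ⟨ModuleCat.ofHom (LinearMap.pi fun a => (g a).hom), ?_⟩
  ext x a
  exact congrArg (fun φ => φ.hom x) (hg a)

lemma of_pi {ι : Type u} (N : ι → Type u) [∀ i, AddCommGroup (N i)] [∀ i, Module R (N i)]
    (h : HomAcyclic P (ModuleCat.of R (∀ i, N i))) (a : ι) :
    HomAcyclic P (ModuleCat.of R (N a)) := by
  classical
  refine h.of_retract (ModuleCat.ofHom (LinearMap.single R N a))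
    (ModuleCat.ofHom (LinearMap.proj a)) ?_
  ext x
  simp

lemma shortExact_of_exact {N₁ N₂ N₃ : Type u}
    [AddCommGroup N₁] [Module R N₁] [AddCommGroup N₂] [Module R N₂] [AddCommGroup N₃] [Module R N₃]
    {f : N₁ →ₗ[R] N₂} {g : N₂ →ₗ[R] N₃} (hf : Function.Injective f) (hfg : Function.Exact f g)
    (hg : Function.Surjective g) :
    (ShortComplex.mk (ModuleCat.ofHom f) (ModuleCat.ofHom g)
      (by ext x; exact hfg.apply_apply_eq_zero x)).ShortExact :=
  ModuleCat.shortComplex_shortExact _ hfg hf hg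

lemma left_of_exact [∀ i, Projective (P.X i)] {N₁ N₂ N₃ : Type u}
    [AddCommGroup N₁] [Module R N₁] [AddCommGroup N₂] [Module R N₂] [AddCommGroup N₃] [Module R N₃]
    {f : N₁ →ₗ[R] N₂} {g : N₂ →ₗ[R] N₃} (hf : Function.Injective f) (hfg : Function.Exact f g)
    (hg : Function.Surjective g) (h₂ : HomAcyclic P (ModuleCat.of R N₂))
    (h₃ : HomAcyclic P (ModuleCat.of R N₃)) : HomAcyclic P (ModuleCat.of R N₁) :=
  X₁_of_shortExact (shortExact_of_exact hf hfg hg) h₂ h₃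

lemma right_of_exact [∀ i, Projective (P.X i)] {N₁ N₂ N₃ : Type u}
    [AddCommGroup N₁] [Module R N₁] [AddCommGroup N₂] [Module R N₂] [AddCommGroup N₃] [Module R N₃]
    {f : N₁ →ₗ[R] N₂} {g : N₂ →ₗ[R] N₃} (hf : Function.Injective f) (hfg : Function.Exact f g)
    (hg : Function.Surjective g) (h₁ : HomAcyclic P (ModuleCat.of R N₁))
    (h₂ : HomAcyclic P (ModuleCat.of R N₂)) : HomAcyclic P (ModuleCat.of R N₃) :=
  X₃_of_shortExact (shortExact_of_exact hf hfg hg) h₁ h₂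

variable {K N : Type u} [AddCommGroup K] [Module R K] [AddCommGroup N] [Module R N]

lemma isIso_smul_id {r : R} (h : Function.Bijective fun x : N => r • x) :
    IsIso (r • 𝟙 (ModuleCat.of R N)) :=
  (ConcreteCategory.isIso_iff_bijective _).mpr h

lemma of_smul_eq_zero_of_bijective (Q : ProjectiveResolution (ModuleCat.of R K)) (r : R)
    (hK : ∀ x : K, r • x = 0) (hN : Function.Bijective fun x : N => r • x) :
    HomAcyclic Q.complex (ModuleCat.of R N) :=
  of_smul_eq_zero_of_isIso Q r (by ext x; exact hK x) (isIso_smul_id hN)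

lemma of_bijective_of_smul_eq_zero (Q : ProjectiveResolution (ModuleCat.of R K)) (r : R)
    (hK : Function.Bijective fun x : K => r • x) (hN : ∀ x : N, r • x = 0) :
    HomAcyclic Q.complex (ModuleCat.of R N) :=
  of_isIso_of_smul_eq_zero Q r (isIso_smul_id hK) (by ext x; exact hN x)

end HomAcyclic

namespace AdicCompletion

section

variable {A : Type*} [CommRing A] (I : Ideal A) (M : Type*) [AddCommGroup M] [Module A M]

/-- The map `(aₙ) ↦ (aₙ - aₙ₊₁)` whose kernel is the adic completion. -/
noncomputable def subShift :
    (∀ n : ℕ, M ⧸ (I ^ n • ⊤ : Submodule A M)) →ₗ[A] (∀ n : ℕ, M ⧸ (I ^ n • ⊤ : Submodule A M)) :=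
  LinearMap.pi fun n =>
    LinearMap.proj n - (transitionMap I M n.le_succ).comp
      (LinearMap.proj (φ := fun n : ℕ => M ⧸ (I ^ n • ⊤ : Submodule A M)) (n + 1))

lemma subShift_apply (a : ∀ n : ℕ, M ⧸ (I ^ n • ⊤ : Submodule A M)) (n : ℕ) :
    subShift I M a n = a n - transitionMap I M n.le_succ (a (n + 1)) := rfl

lemma incl_injective : Function.Injective (incl I M) := fun _ _ h => Subtype.ext h

lemma exact_incl_subShift : Function.Exact (incl I M) (subShift I M) := by
  intro a
  constructor
  · intro h
    have hs (n : ℕ) : transitionMap I M n.le_succ (a (n + 1)) = a n :=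
      (sub_eq_zero.mp (congrFun h n)).symm
    refine ⟨⟨a, fun {m n} hmn => ?_⟩, rfl⟩
    induction n, hmn using Nat.le_induction with
    | base => obtain ⟨x, hx⟩ := Submodule.mkQ_surjective _ (a m); rw [← hx]; rfl
    | succ n hmn ih =>
      rw [← ih, ← hs n]
      obtain ⟨x, hx⟩ := Submodule.mkQ_surjective _ (a (n + 1))
      rw [← hx]
      rfl
  · rintro ⟨b, rfl⟩
    funext n
    exact sub_eq_zero.mpr (b.2 n.le_succ).symm

lemma subShift_surjective : Function.Surjective (subShift I M) := by
  intro b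
  have ht (n : ℕ) : Function.Surjective (transitionMap I M n.le_succ) :=
    Submodule.factor_surjective _
  choose t ht using ht
  let a : ∀ n : ℕ, M ⧸ (I ^ n • ⊤ : Submodule A M) :=
    fun n => Nat.rec 0 (fun n x => t n (x - b n)) n
  refine ⟨a, funext fun n => ?_⟩
  rw [subShift_apply, show a (n + 1) = t n (a n - b n) from rfl, ht, sub_sub_cancel]

end

/-- Completing an `A`-module at an ideal of `R` or at its extension to `A` gives the same thing. -/
noncomputable def mapAlgebraMapEquiv {R A : Type*} [CommRing R] [CommRing A] [Algebra R A]
    (I : Ideal R) :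
    AdicCompletion I A ≃ₗ[R] AdicCompletion (I.map (algebraMap R A)) A :=
  have h (n : ℕ) : (I ^ n • ⊤ : Submodule R A) =
      ((I.map (algebraMap R A)) ^ n • ⊤ : Submodule A A).restrictScalars R := by
    rw [← Ideal.map_pow, Submodule.restrictScalars_map_smul_eq]; rfl
  let e (n : ℕ) : (A ⧸ (I ^ n • ⊤ : Submodule R A)) ≃ₗ[R]
      A ⧸ ((I.map (algebraMap R A)) ^ n • ⊤ : Submodule A A) :=
    (Submodule.quotEquivOfEq _ _ (h n)).trans (Submodule.Quotient.restrictScalarsEquiv R _)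
  have he {m n : ℕ} (hmn : m ≤ n) (x) : transitionMap _ A hmn (e n x) =
      e m (transitionMap I A hmn x) := by
    obtain ⟨y, rfl⟩ := Submodule.mkQ_surjective _ x
    rfl
  { toFun := fun x => ⟨fun n => e n (x.1 n), fun {m n} hmn => by rw [he, x.2]⟩
    invFun := fun x => ⟨fun n => (e n).symm (x.1 n), fun {m n} hmn => by
      apply (e m).injective
      rw [← he, LinearEquiv.apply_symm_apply, LinearEquiv.apply_symm_apply, x.2]⟩
    map_add' := fun x y => ext fun n => map_add (e n) _ _
    map_smul' := fun r x => ext fun n => map_smul (e n) _ _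
    left_inv := fun x => ext fun n => (e n).symm_apply_apply _
    right_inv := fun x => ext fun n => (e n).apply_symm_apply _ }

end AdicCompletion

open TensorProduct

namespace HomAcyclic

variable {R : Type u} [CommRing R]

lemma adicCompletion {A : Type u} [CommRing A] [Algebra R A] (I : Ideal A)
    {K : Type u} [AddCommGroup K] [Module R K] (Q : ProjectiveResolution (ModuleCat.of R K)) (r : R)
    (hr : algebraMap R A r ∈ I) (hK : Function.Bijective fun x : K => r • x) :
    HomAcyclic Q.complex (ModuleCat.of R (AdicCompletion I A)) := by
  have hpi : HomAcyclic Q.complex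
      (ModuleCat.of R (∀ n : ULift.{u} ℕ, A ⧸ (I ^ n.down • ⊤ : Submodule A A))) := by
    refine pi _ fun n => of_bijective_of_smul_eq_zero Q (r ^ n.down) ?_ fun x => ?_
    · have : (fun x : K => r ^ n.down • x) = (fun x : K => r • x)^[n.down] := by
        rw [smul_iterate]
      rw [this]
      exact hK.iterate _
    · obtain ⟨y, rfl⟩ := Submodule.mkQ_surjective _ x
      rw [← algebraMap_smul A (r ^ n.down), ← map_smul, map_pow, Submodule.mkQ_apply,
        Submodule.Quotient.mk_eq_zero]
      exact Submodule.smul_mem_smul (Ideal.pow_mem_pow hr _) Submodule.mem_top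
  have hpi' : HomAcyclic Q.complex
      (ModuleCat.of R (∀ n : ℕ, A ⧸ (I ^ n • ⊤ : Submodule A A))) :=
    hpi.of_linearEquiv (LinearEquiv.piCongrLeft R
      (fun n : ℕ => A ⧸ (I ^ n • ⊤ : Submodule A A)) Equiv.ulift)
  exact left_of_exact (f := (AdicCompletion.incl I A).restrictScalars R)
    (g := (AdicCompletion.subShift I A).restrictScalars R)
    (AdicCompletion.incl_injective I A) (AdicCompletion.exact_incl_subShift I A)
    (AdicCompletion.subShift_surjective I A) hpi' hpi'

section LocalRing

variable {A : Type u} [CommRing A] [Algebra R A] [IsLocalRing A]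

lemma not_residueField (Q : ProjectiveResolution (ModuleCat.of R (IsLocalRing.ResidueField A)))
    {N : Type u} [AddCommGroup N] [Module R N] (f : IsLocalRing.ResidueField A →ₗ[R] N)
    (hf : f ≠ 0) : ¬ HomAcyclic Q.complex (ModuleCat.of R N) := fun h =>
  hf (congrArg ModuleCat.Hom.hom (comp_eq_zero Q h (ModuleCat.ofHom f)))

variable [IsNoetherianRing A] {M : Type u} [AddCommGroup M] [Module A M] [Module.Flat A M]

lemma not_quotient_tensorProduct [Nontrivial (IsLocalRing.ResidueField A ⊗[A] M)]
    (Q : ProjectiveResolution (ModuleCat.of R (IsLocalRing.ResidueField A)))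
    (J : Ideal A) (hJ : J ≠ ⊤) : ¬ HomAcyclic Q.complex (ModuleCat.of R ((A ⧸ J) ⊗[A] M)) := by
  induction J using IsNoetherian.induction with
  | hgt J ih =>
  have := Ideal.Quotient.nontrivial_iff.mpr hJ
  by_cases hs : Subsingleton (IsLocalRing.ResidueField A →ₗ[A] A ⧸ J)
  · intro h
    obtain ⟨x, hx, hreg⟩ := IsSMulRegular.subsingleton_linearMap_iff.mp hs
    have hxm : x ∈ IsLocalRing.maximalIdeal A := by
      rw [← IsLocalRing.residue_eq_zero_iff]
      have := Module.mem_annihilator.mp hx 1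
      rwa [Algebra.smul_def, mul_one] at this
    have hxJ : x ∉ J := by
      intro hxJ
      have h1 : x • (1 : A ⧸ J) = x • 0 := by
        rw [smul_zero, Algebra.smul_def, mul_one]
        exact Ideal.Quotient.eq_zero_iff_mem.mpr hxJ
      exact one_ne_zero (hreg h1)
    have hJm := IsLocalRing.le_maximalIdeal hJ
    have hle : J ⊔ Ideal.span {x} ≤ IsLocalRing.maximalIdeal A :=
      sup_le hJm ((Ideal.span_singleton_le_iff_mem _).mpr hxm)
    have hlt : J < J ⊔ Ideal.span {x} := by
      refine lt_of_le_of_ne le_sup_left fun he => hxJ ?_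
      rw [he]
      exact Ideal.mem_sup_right (Ideal.mem_span_singleton_self x)
    refine ih _ hlt (ne_top_of_le_ne_top (IsLocalRing.maximalIdeal.isMaximal A).ne_top hle) ?_
    let f : (A ⧸ J) →ₗ[A] A ⧸ J := LinearMap.lsmul A _ x
    let g : (A ⧸ J) →ₗ[A] A ⧸ (J ⊔ Ideal.span {x}) := Submodule.factor le_sup_left
    have hg : Function.Surjective g := Submodule.factor_surjective _
    have hfg : Function.Exact f g := by
      intro y
      obtain ⟨y, rfl⟩ := Ideal.Quotient.mk_surjective y
      constructor
      · intro hy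
        have hy : y ∈ J ⊔ Ideal.span {x} := Ideal.Quotient.eq_zero_iff_mem.mp hy
        obtain ⟨j, hj, z, hz, rfl⟩ := Submodule.mem_sup.mp hy
        obtain ⟨a, rfl⟩ := Ideal.mem_span_singleton'.mp hz
        refine ⟨Ideal.Quotient.mk J a, ?_⟩
        rw [map_add, Ideal.Quotient.eq_zero_iff_mem.mpr hj, zero_add, mul_comm]
        rfl
      · rintro ⟨z, hz⟩
        obtain ⟨z, rfl⟩ := Ideal.Quotient.mk_surjective z
        rw [← hz]
        refine (Ideal.Quotient.eq_zero_iff_mem (I := J ⊔ Ideal.span {x}) (a := x * z)).mpr ?_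
        exact Ideal.mem_sup_right (Ideal.mul_mem_right _ _ (Ideal.mem_span_singleton_self x))
    exact right_of_exact (f := (f.rTensor M).restrictScalars R)
      (g := (g.rTensor M).restrictScalars R)
      (Module.Flat.rTensor_preserves_injective_linearMap f hreg) (rTensor_exact M hfg hg)
      (LinearMap.rTensor_surjective M hg) h h
  · obtain ⟨f, hf⟩ : ∃ f : IsLocalRing.ResidueField A →ₗ[A] A ⧸ J, f ≠ 0 := by
      by_contra! h
      exact hs ⟨fun a b => (h a).trans (h b).symm⟩
    have hfi : Function.Injective f := by
      have : IsSimpleModule A (IsLocalRing.ResidueField A) :=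
        isSimpleModule_iff_isCoatom.mpr (IsLocalRing.maximalIdeal.isMaximal A).out
      exact (LinearMap.injective_or_eq_zero f).resolve_right hf
    obtain ⟨z, hz⟩ := exists_ne (0 : IsLocalRing.ResidueField A ⊗[A] M)
    let s : IsLocalRing.ResidueField A →ₗ[A] IsLocalRing.ResidueField A ⊗[A] M :=
      (LinearMap.toSpanSingleton (IsLocalRing.ResidueField A) _ z).restrictScalars A
    refine not_residueField Q (((f.rTensor M).comp s).restrictScalars R) fun h => hz ?_
    refine Module.Flat.rTensor_preserves_injective_linearMap (M := M) f hfi ?_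
    rw [map_zero]
    have := LinearMap.congr_fun h 1
    simpa [s] using this

lemma not_of_flat [Module R M] [IsScalarTower R A M]
    [Nontrivial (IsLocalRing.ResidueField A ⊗[A] M)]
    (Q : ProjectiveResolution (ModuleCat.of R (IsLocalRing.ResidueField A))) :
    ¬ HomAcyclic Q.complex (ModuleCat.of R M) := by
  intro h
  refine not_quotient_tensorProduct (M := M) Q ⊥ bot_ne_top ?_
  let e : M ≃ₗ[A] (A ⧸ (⊥ : Ideal A)) ⊗[A] M := (TensorProduct.lid A M).symm.trans
    (TensorProduct.congr (Submodule.quotEquivOfEqBot ⊥ rfl).symm (LinearEquiv.refl A M))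
  exact h.of_linearEquiv (e.restrictScalars R)

end LocalRing

end HomAcyclic

lemma nontrivial_residueField_tensorProduct_adicCompletion (A : Type*) [CommRing A] [IsLocalRing A]
    (I : Ideal A) (hI : I ≤ IsLocalRing.maximalIdeal A) :
    Nontrivial (IsLocalRing.ResidueField A ⊗[A] AdicCompletion I A) := by
  let g : AdicCompletion I A →ₗ[A] IsLocalRing.ResidueField A :=
    (Submodule.liftQ _ (Algebra.linearMap A (IsLocalRing.ResidueField A)) (by
      rw [pow_one, Submodule.smul_le]
      intro a ha b _
      rw [LinearMap.mem_ker, map_smul, Algebra.smul_def]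
      have : algebraMap A (IsLocalRing.ResidueField A) a = 0 :=
        (IsLocalRing.residue_eq_zero_iff a).mpr (hI ha)
      rw [this, zero_mul])).comp (AdicCompletion.eval I A 1)
  let t : IsLocalRing.ResidueField A ⊗[A] AdicCompletion I A →ₗ[A] IsLocalRing.ResidueField A :=
    (LinearMap.mul' A _).comp (g.lTensor _)
  refine nontrivial_of_ne (1 ⊗ₜ AdicCompletion.of I A 1) 0 fun h => ?_
  have ht : t (1 ⊗ₜ AdicCompletion.of I A 1) = 1 := by
    change (1 : IsLocalRing.ResidueField A) * algebraMap A (IsLocalRing.ResidueField A) 1 = 1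
    rw [map_one, one_mul]
  rw [h, map_zero] at ht
  exact zero_ne_one ht

theorem homAcyclic_completion_iff {R : Type u} [CommRing R] [IsNoetherianRing R]
    (p q : PrimeSpectrum R) (Q : ProjectiveResolution
      (ModuleCat.of R (IsLocalRing.ResidueField (Localization.AtPrime q.asIdeal)))) :
    HomAcyclic Q.complex (ModuleCat.of R
      (AdicCompletion p.asIdeal (Localization.AtPrime p.asIdeal))) ↔ q ≠ p := by
  let A := Localization.AtPrime p.asIdeal
  let κ := IsLocalRing.ResidueField (Localization.AtPrime q.asIdeal)
  let I : Ideal A := p.asIdeal.map (algebraMap R A)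
  have hI : I = IsLocalRing.maximalIdeal A := Localization.AtPrime.map_eq_maximalIdeal
  have : IsNoetherianRing A := IsLocalization.isNoetherianRing p.asIdeal.primeCompl A ‹_›
  let e : AdicCompletion p.asIdeal A ≃ₗ[R] AdicCompletion I A :=
    AdicCompletion.mapAlgebraMapEquiv p.asIdeal
  constructor
  · rintro h rfl
    have := nontrivial_residueField_tensorProduct_adicCompletion A I hI.le
    exact HomAcyclic.not_of_flat (A := A) (M := AdicCompletion I A) Q (h.of_linearEquiv e)
  · intro hqp
    refine HomAcyclic.of_linearEquiv e.symm ?_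
    by_cases hle : q.asIdeal ≤ p.asIdeal
    · obtain ⟨x, hxp, hxq⟩ : ∃ x ∈ p.asIdeal, x ∉ q.asIdeal := by
        by_contra! h
        exact hqp (PrimeSpectrum.ext (le_antisymm hle h))
      refine HomAcyclic.adicCompletion I Q x (Ideal.mem_map_of_mem _ hxp) ?_
      have hu : IsUnit (algebraMap R (Localization.AtPrime q.asIdeal) x) :=
        IsLocalization.map_units (M := q.asIdeal.primeCompl) _ ⟨x, hxq⟩
      have hb := (Module.End.isUnit_iff _).mp (hu.map
        (algebraMap _ (Module.End (Localization.AtPrime q.asIdeal) κ)))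
      convert hb using 2 with y
      exact (algebraMap_smul (Localization.AtPrime q.asIdeal) x y).symm
    · obtain ⟨x, hxq, hxp⟩ := SetLike.not_le_iff_exists.mp hle
      refine HomAcyclic.of_smul_eq_zero_of_bijective Q x (fun y => ?_) ?_
      · have hx : algebraMap R (Localization.AtPrime q.asIdeal) x ∈
            IsLocalRing.maximalIdeal (Localization.AtPrime q.asIdeal) := by
          rw [← Localization.AtPrime.map_eq_maximalIdeal]
          exact Ideal.mem_map_of_mem _ hxq
        rw [← algebraMap_smul (Localization.AtPrime q.asIdeal), Algebra.smul_def]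
        have h0 := (IsLocalRing.residue_eq_zero_iff _).mpr hx
        exact mul_eq_zero_of_left h0 y
      · have hu : IsUnit (algebraMap R A x) :=
          IsLocalization.map_units (M := p.asIdeal.primeCompl) _ ⟨x, hxp⟩
        have hb := (Module.End.isUnit_iff _).mp
          (hu.map (algebraMap _ (Module.End A (AdicCompletion I A))))
        convert hb using 2 with y
        exact (algebraMap_smul A x y).symm

end

/-!
STATEMENT 15: Let `R` be commutative noetherian of finite Krull dimension and
`W ⊆ Spec R`.  The module `M = ∏_{p ∈ W} Λ^p(R_p)` has cosupport exactly `W`.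
-/
theorem cosupport_prod_completions (R : Type u) [CommRing R] [IsNoetherianRing R]
    (hdim : ringKrullDim R < ⊤) (W : Set (PrimeSpectrum R)) :
    ∀ q : PrimeSpectrum R,
      q ∈ moduleCosupport R
        ((p : W) → AdicCompletion p.1.asIdeal (Localization.AtPrime p.1.asIdeal)) ↔
      q ∈ W := by
  intro q
  let Q := ProjectiveResolution.of
    (ModuleCat.of R (IsLocalRing.ResidueField (Localization.AtPrime q.asIdeal)))
  have h := homAcyclic_iff_ext R Q (ModuleCat.of R
    ((p : W) → AdicCompletion p.1.asIdeal (Localization.AtPrime p.1.asIdeal)))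
  rw [← not_iff_not]
  simp only [moduleCosupport, Set.mem_ofPred_eq, not_exists, not_nontrivial_iff_subsingleton]
  rw [← h]
  constructor
  · intro hM hq
    exact (homAcyclic_completion_iff q q Q).mp (hM.of_pi _ ⟨q, hq⟩) rfl
  · intro hq
    refine HomAcyclic.pi _ fun p => (homAcyclic_completion_iff p.1 q Q).mpr ?_
    rintro rfl
    exact hq p.2
end

section
/- Let R be a commutative noetherian ring of finite Krull dimension and let p be a prime ideal of R, with residue field κ(p) = R_p/pR_p regarded as an R-module. Then for every prime ideal q of R, there exists i ≥ 0 with Ext^i_R(κ(q), κ(p)) ≠ 0 if and only if q = p; that is, the cosupport of κ(p) is exactly {p}. -/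
open CategoryTheory Opposite

universe u

open Limits

section Ext

variable {R : Type*} [CommRing R] {C : Type*} [Category* C] [Abelian C] [Linear R C]
  [EnoughProjectives C]

lemma leftDerived_linearYoneda_map_smul_id (r : R) (X Y : C) (n : ℕ) :
    (((linearYoneda R C).obj Y).rightOp.leftDerived n).map (r • 𝟙 X) =
      (NatTrans.leftDerived
        (NatTrans.rightOp ((linearYoneda R C).map (r • 𝟙 Y))) n).app X := by
  let P := projectiveResolution X
  rw [ProjectiveResolution.leftDerived_app_eq _ P,
    Functor.leftDerived_map_eq _ n (r • 𝟙 X) (P := P) (Q := P) (r • 𝟙 P.complex) ?_]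
  · dsimp only [Functor.comp_map]
    congr 3
    ext i : 1
    apply Quiver.Hom.unop_inj
    ext (f : P.complex.X i ⟶ Y)
    change (r • 𝟙 (P.complex.X i)) ≫ f = f ≫ (r • 𝟙 Y)
    simp
  · ext
    simp only [HomologicalComplex.comp_f, Linear.smul_comp, Category.id_comp,
      HomologicalComplex.smul_f_apply, ChainComplex.single₀_map_f_zero]
    exact ((Linear.comp_smul _ _ X (P.π.f 0) r (𝟙 X)).trans
      (congrArg (r • ·) (Category.comp_id (P.π.f 0)))).symm

lemma isZero_Ext_of_smul_id_left_eq_zero {r : R} {X Y : C} (hX : r • 𝟙 X = 0)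
    [IsIso (r • 𝟙 Y)] (n : ℕ) :
    IsZero (((Ext R C n).obj (op X)).obj Y) := by
  have h := leftDerived_linearYoneda_map_smul_id r X Y n
  have hi : IsIso (((Ext R C n).obj (op X)).map (r • 𝟙 Y)) := inferInstance
  have h0 : ((Ext R C n).obj (op X)).map (r • 𝟙 Y) = 0 := by
    apply Quiver.Hom.op_inj
    refine h.symm.trans ?_
    rw [hX, Functor.leftDerived_map_eq _ n 0 (P := projectiveResolution X)
      (Q := projectiveResolution X) 0 (by simp)]
    rw [Functor.map_zero]
    erw [zero_comp, comp_zero]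
    rfl
  rw [h0] at hi
  exact (IsZero.iff_id_eq_zero _).2 (isIsoZeroEquiv _ _ hi).1

lemma isZero_Ext_of_smul_id_right_eq_zero {r : R} {X Y : C} (hY : r • 𝟙 Y = 0)
    [IsIso (r • 𝟙 X)] (n : ℕ) :
    IsZero (((Ext R C n).obj (op X)).obj Y) := by
  have h := leftDerived_linearYoneda_map_smul_id r X Y n
  have hi : IsIso (((Ext R C n).map (r • 𝟙 X).op).app Y) := inferInstance
  have h0 : ((Ext R C n).map (r • 𝟙 X).op).app Y = 0 := by
    apply Quiver.Hom.op_inj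
    refine h.trans ?_
    rw [hY, ProjectiveResolution.leftDerived_app_eq _ (projectiveResolution X)]
    have : (NatTrans.mapHomologicalComplex (NatTrans.rightOp ((linearYoneda R C).map (0 : Y ⟶ Y)))
        (ComplexShape.down ℕ)).app (projectiveResolution X).complex = 0 := by
      ext i : 1
      apply Quiver.Hom.unop_inj
      ext (f : (projectiveResolution X).complex.X i ⟶ Y)
      exact comp_zero
    rw [this]
    rw [Functor.map_zero]
    erw [zero_comp, comp_zero]
    rfl
  rw [h0] at hi
  exact (IsZero.iff_id_eq_zero _).2 (isIsoZeroEquiv _ _ hi).1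

instance linearYoneda_obj_preservesLimits (Y : C) :
    PreservesLimits ((linearYoneda R C).obj Y) :=
  have : PreservesLimits ((linearYoneda R C).obj Y ⋙ forget (ModuleCat R)) :=
    inferInstanceAs (PreservesLimits (yoneda.obj Y))
  preservesLimits_of_reflects_of_preserves _ (forget (ModuleCat R))

instance linearYoneda_obj_rightOp_preservesFiniteColimits (Y : C) :
    PreservesFiniteColimits ((linearYoneda R C).obj Y).rightOp :=
  preservesFiniteColimits_rightOp _

/-- `Ext^0(X, Y)` is isomorphic to the module of morphisms from `X` to `Y`. -/
noncomputable def extZeroIso (X Y : C) :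
    ((Ext R C 0).obj (op X)).obj Y ≅ ModuleCat.of R (X ⟶ Y) :=
  (((linearYoneda R C).obj Y).rightOp.leftDerivedZeroIsoSelf.app X).unop.symm

end Ext

section ResidueField

variable {R : Type u} [CommRing R]

lemma smul_id_residueField_eq_zero {p : Ideal R} [p.IsPrime] {r : R} (hr : r ∈ p) :
    r • 𝟙 (ModuleCat.of R (IsLocalRing.ResidueField (Localization.AtPrime p))) = 0 := by
  ext x
  change r • x = 0
  have h : algebraMap R p.ResidueField r = 0 := Ideal.algebraMap_residueField_eq_zero.2 hr
  rw [Algebra.smul_def, h, zero_mul]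

lemma isIso_smul_id_residueField {p : Ideal R} [p.IsPrime] {r : R} (hr : r ∉ p) :
    IsIso (r • 𝟙 (ModuleCat.of R (IsLocalRing.ResidueField (Localization.AtPrime p)))) := by
  have h : algebraMap R p.ResidueField r ≠ 0 := fun h ↦
    hr (Ideal.algebraMap_residueField_eq_zero.1 h)
  rw [ConcreteCategory.isIso_iff_bijective]
  convert mulLeft_bijective₀ _ h using 1
  ext x
  exact Algebra.smul_def r x

end ResidueField

/-!
STATEMENT 16: Let `R` be commutative noetherian of finite Krull dimension and `p` a
prime of `R`.  The cosupport of the residue field `κ(p)`, regarded as an `R`-module,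
is exactly `{p}`.
-/
theorem cosupport_residueField (R : Type u) [CommRing R] [IsNoetherianRing R]
    (hdim : ringKrullDim R < ⊤) (p : PrimeSpectrum R) :
    ∀ q : PrimeSpectrum R,
      q ∈ moduleCosupport R (IsLocalRing.ResidueField (Localization.AtPrime p.asIdeal)) ↔
        q = p := by
  intro q
  constructor
  · rintro ⟨i, hi⟩
    by_contra hqp
    have hne : ¬ (∀ r, r ∈ q.asIdeal ↔ r ∈ p.asIdeal) := fun h ↦
      hqp (PrimeSpectrum.ext (Ideal.ext h))
    refine not_subsingleton_iff_nontrivial.2 hi (ModuleCat.subsingleton_of_isZero ?_)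
    push Not at hne
    obtain ⟨r, ⟨hq, hp⟩ | ⟨hq, hp⟩⟩ := hne
    · have := isIso_smul_id_residueField hp
      exact isZero_Ext_of_smul_id_left_eq_zero (smul_id_residueField_eq_zero hq) i
    · have := isIso_smul_id_residueField hq
      exact isZero_Ext_of_smul_id_right_eq_zero (smul_id_residueField_eq_zero hp) i
  · rintro rfl
    refine ⟨0, ?_⟩
    rw [← not_subsingleton_iff_nontrivial]
    intro h
    let M := ModuleCat.of R (IsLocalRing.ResidueField (Localization.AtPrime q.asIdeal))
    have h' : Subsingleton (M ⟶ M) :=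
      (extZeroIso (R := R) M M).toLinearEquiv.symm.toEquiv.subsingleton
    have h1 := congrArg (fun f : M ⟶ M ↦ f.hom
      (1 : IsLocalRing.ResidueField (Localization.AtPrime q.asIdeal))) (Subsingleton.elim (𝟙 M) 0)
    exact one_ne_zero (α := IsLocalRing.ResidueField (Localization.AtPrime q.asIdeal)) h1
end

section
/- Let R be a commutative noetherian ring such that for every prime ideal p the localization R_p has finite projective dimension as an R-module (this holds, for instance, when R has finite Krull dimension), and let M be a finitely generated R-module. Then for every prime ideal p of R: there exists i ≥ 0 with Ext^i_R(κ(p), M) ≠ 0 if and only if both M_p ≠ 0 and there exists j ≥ 0 with Ext^j_R(κ(p), R) ≠ 0. That is, the cosupport of M equals the intersection of the support of M with the cosupport of R. -/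
open CategoryTheory Opposite

universe u

section
variable {R : Type u} [CommRing R]

lemma CategoryTheory.ProjectiveResolution.extMk_degree_zero_eq_zero_iff
    {C : Type*} [Category C] [Abelian C] [HasExt C] {X Y : C} (P : ProjectiveResolution X) (f : P.complex.X 0 ⟶ Y) (hf : P.complex.d 1 0 ≫ f = 0) :
    P.extMk f 1 rfl hf = 0 ↔ f = 0 := by
  refine ⟨fun h ↦ ?_, by rintro rfl; simp⟩
  simp only [← P.extEquivCohomologyClass.apply_eq_iff_eq,
    P.extEquivCohomologyClass_extMk, P.extEquivCohomologyClass_zero,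
    CochainComplex.HomComplex.CohomologyClass.mk_eq_zero_iff] at h
  rw [CochainComplex.HomComplex.Cocycle.toSingleMk_mem_coboundaries_iff _ _ _ _ _ 1 (by lia)] at h
  obtain ⟨g, hg⟩ := h
  have : P.cochainComplex.d (-(0:ℕ)) 1 = 0 := by
    apply Limits.IsZero.eq_of_tgt
    exact CochainComplex.isZero_of_isStrictlyLE _ 0 _ (by simp)
  rw [← cancel_epi (P.cochainComplexXIso (-(0:ℕ)) 0 rfl).hom, ← hg, this]
  simp

/-- The derived functor `Ext` and the groups `Abelian.Ext` vanish simultaneously. -/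
lemma nontrivial_ext_iff (X Y : ModuleCat.{u} R) (n : ℕ) :
    Nontrivial (((Ext R (ModuleCat.{u} R) n).obj (op X)).obj Y) ↔
      Nontrivial (Abelian.Ext X Y n) := by
  rw [← not_subsingleton_iff_nontrivial, ← not_subsingleton_iff_nontrivial, not_iff_not]
  let P := projectiveResolution X
  rw [← ModuleCat.isZero_iff_subsingleton, (P.isoExt n Y).isZero_iff,
    ← HomologicalComplex.exactAt_iff_isZero_homology]
  have key : Subsingleton (Abelian.Ext X Y n) ↔ ∀ (f : P.complex.X n ⟶ Y)
      (hf : P.complex.d (n + 1) n ≫ f = 0), P.extMk f _ rfl hf = 0 := by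
    refine ⟨fun h f hf ↦ Subsingleton.elim _ _, fun h ↦ subsingleton_of_forall_eq 0 fun x ↦ ?_⟩
    obtain ⟨f, hf, rfl⟩ := P.extMk_surjective x _ rfl
    exact h f hf
  rw [key]
  cases n with
  | zero =>
    simp only [P.extMk_degree_zero_eq_zero_iff]
    rw [HomologicalComplex.exactAt_iff' _ 0 0 1 (by simp) (by simp),
      ShortComplex.moduleCat_exact_iff]
    refine forall₂_congr fun f hf ↦ ⟨?_, ?_⟩
    · rintro ⟨g, hg⟩
      rw [← hg]
      have h₀ : P.complex.d 0 0 = 0 := P.complex.shape _ _ (by simp)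
      exact (congrArg (· ≫ (g : P.complex.X 0 ⟶ Y)) h₀).trans Limits.zero_comp
    · rintro rfl
      exact ⟨0, map_zero _⟩
  | succ n =>
    simp only [P.extMk_eq_zero_iff _ _ _ _ n rfl]
    rw [HomologicalComplex.exactAt_iff' _ n (n + 1) (n + 2) (by simp) (by simp),
      ShortComplex.moduleCat_exact_iff]
    rfl

open Abelian

section ShortExact

variable {C : Type*} [Category C] [Abelian C] [HasExt C] {S : ShortComplex C}

lemma CategoryTheory.ShortComplex.ShortExact.subsingleton_ext_X₁ (hS : S.ShortExact) (X : C)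
    (n : ℕ) [Subsingleton (Ext X S.X₂ n)] (h : ∀ i, i + 1 = n → Subsingleton (Ext X S.X₃ i)) :
    Subsingleton (Ext X S.X₁ n) := by
  refine subsingleton_of_forall_eq 0 fun x ↦ ?_
  have hx : x.comp (Ext.mk₀ S.f) (add_zero n) = 0 := Subsingleton.elim _ _
  cases n with
  | zero =>
    have := hS.mono_f
    exact Ext.postcomp_mk₀_injective_of_mono X S.f (hx.trans (map_zero _).symm)
  | succ n =>
    have := h n rfl
    obtain ⟨z, rfl⟩ := Ext.covariant_sequence_exact₁ X hS x hx rfl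
    rw [Subsingleton.elim z 0, Ext.zero_comp]

lemma CategoryTheory.ShortComplex.ShortExact.subsingleton_ext_X₂ (hS : S.ShortExact) (X : C)
    (n : ℕ) [Subsingleton (Ext X S.X₁ n)] [Subsingleton (Ext X S.X₃ n)] :
    Subsingleton (Ext X S.X₂ n) := by
  refine subsingleton_of_forall_eq 0 fun x ↦ ?_
  obtain ⟨z, rfl⟩ := Ext.covariant_sequence_exact₂ X hS x (Subsingleton.elim _ _)
  rw [Subsingleton.elim z 0, Ext.zero_comp]

lemma CategoryTheory.ShortComplex.ShortExact.subsingleton_ext_X₃ (hS : S.ShortExact) (X : C)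
    (n : ℕ) [Subsingleton (Ext X S.X₁ (n + 1))] [Subsingleton (Ext X S.X₂ n)] :
    Subsingleton (Ext X S.X₃ n) := by
  refine subsingleton_of_forall_eq 0 fun x ↦ ?_
  obtain ⟨z, rfl⟩ := Ext.covariant_sequence_exact₃ X hS x rfl (Subsingleton.elim _ _)
  rw [Subsingleton.elim z 0, Ext.zero_comp]

end ShortExact

lemma Ext.subsingleton_of_linearEquiv (X : ModuleCat.{u} R) {M N : Type u} [AddCommGroup M]
    [Module R M] [AddCommGroup N] [Module R N] (e : M ≃ₗ[R] N) (n : ℕ)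
    [Subsingleton (Ext X (ModuleCat.of R M) n)] : Subsingleton (Ext X (ModuleCat.of R N) n) := by
  refine subsingleton_of_forall_eq 0 fun x ↦ ?_
  have h := Ext.comp_mk₀_id x
  rw [← e.toModuleIso.inv_hom_id, ← Ext.mk₀_comp_mk₀, ← Ext.comp_assoc_of_third_deg_zero,
    Subsingleton.elim (x.comp (Ext.mk₀ e.toModuleIso.inv) (add_zero n)) 0, Ext.zero_comp] at h
  exact h.symm

lemma Ext.smul_eq_zero_of_forall_smul_eq_zero (X : ModuleCat.{u} R) {M : Type u} [AddCommGroup M]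
    [Module R M] {n : ℕ} (s : R) (hs : ∀ m : M, s • m = 0) (x : Ext X (ModuleCat.of R M) n) :
    s • x = 0 := by
  have : s • 𝟙 (ModuleCat.of R M) = 0 := by
    ext m
    exact hs m
  rw [Ext.smul_eq_comp_mk₀, this, Ext.mk₀_zero, Ext.comp_zero]

/-- An object `X` on which the elements of `p` act by zero and the elements outside of `p` act
invertibly, at the level of the groups `Ext X Y n`. -/
structure ActsLikeResidueField (p : Ideal R) (X : ModuleCat.{u} R) : Prop where
  smul_eq_zero : ∀ {Y : ModuleCat.{u} R} {n : ℕ} {y : R}, y ∈ p → ∀ x : Ext X Y n, y • x = 0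
  eq_zero_of_smul : ∀ {Y : ModuleCat.{u} R} {n : ℕ} {s : R}, s ∉ p →
    ∀ x : Ext X Y n, s • x = 0 → x = 0

namespace ActsLikeResidueField

lemma residueField (p : PrimeSpectrum R) : ActsLikeResidueField p.asIdeal
    (ModuleCat.of R (IsLocalRing.ResidueField (Localization.AtPrime p.asIdeal))) where
  smul_eq_zero {Y n y} hy x := by
    have h : y • 𝟙 (ModuleCat.of R
        (IsLocalRing.ResidueField (Localization.AtPrime p.asIdeal))) = 0 := by
      ext m
      change y • m = 0
      rw [Algebra.smul_def, (Ideal.algebraMap_residueField_eq_zero (I := p.asIdeal)).2 hy, zero_mul]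
    rw [← Ext.mk₀_id_comp x, ← Ext.smul_comp, ← Ext.mk₀_smul, h, Ext.mk₀_zero, Ext.zero_comp]
  eq_zero_of_smul {Y n s} hs x hx := by
    have hs' : algebraMap R (IsLocalRing.ResidueField (Localization.AtPrime p.asIdeal)) s ≠ 0 :=
      fun h ↦ hs ((Ideal.algebraMap_residueField_eq_zero (I := p.asIdeal)).1 h)
    let u : Module.End R (IsLocalRing.ResidueField (Localization.AtPrime p.asIdeal)) :=
      LinearMap.mulLeft R (algebraMap R _ s)⁻¹
    have h : s • ModuleCat.ofHom u = 𝟙 (ModuleCat.of R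
        (IsLocalRing.ResidueField (Localization.AtPrime p.asIdeal))) := by
      ext m
      change s • ((algebraMap R _ s)⁻¹ * m) = m
      rw [Algebra.smul_def, mul_inv_cancel_left₀ hs']
    rw [← Ext.mk₀_id_comp x, ← h, Ext.mk₀_smul, Ext.smul_comp, ← Ext.comp_smul, hx, Ext.comp_zero]

variable {p : Ideal R} {X : ModuleCat.{u} R} (hX : ActsLikeResidueField p X)
include hX

lemma subsingleton_ext_of_forall_smul_eq_zero {M : Type u} [AddCommGroup M] [Module R M]
    {s : R} (hs : s ∉ p) (hM : ∀ m : M, s • m = 0) (n : ℕ) :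
    Subsingleton (Ext X (ModuleCat.of R M) n) :=
  subsingleton_of_forall_eq 0 fun x ↦
    hX.eq_zero_of_smul hs x (Ext.smul_eq_zero_of_forall_smul_eq_zero X s hM x)

open Pointwise in
lemma subsingleton_ext_of_isSMulRegular {M : Type u} [AddCommGroup M] [Module R M]
    {y : R} (hy : y ∈ p) (hM : IsSMulRegular M y) (n : ℕ)
    (h : ∀ i, i + 1 = n → Subsingleton (Ext X (ModuleCat.of R (M ⧸ y • (⊤ : Submodule R M))) i)) :
    Subsingleton (Ext X (ModuleCat.of R M) n) := by
  have hS := IsSMulRegular.smulShortComplex_shortExact (M := ModuleCat.of R M) hM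
  refine subsingleton_of_forall_eq 0 fun x ↦ ?_
  have hx : x.comp (Ext.mk₀ (ModuleCat.smulShortComplex (ModuleCat.of R M) y).f)
      (add_zero n) = 0 := by
    rw [ModuleCat.smulShortComplex_f_eq_smul_id]
    exact (Ext.smul_eq_comp_mk₀ x y).symm.trans (hX.smul_eq_zero hy x)
  cases n with
  | zero =>
    have := hS.mono_f
    exact Ext.postcomp_mk₀_injective_of_mono X
      (ModuleCat.smulShortComplex (ModuleCat.of R M) y).f (hx.trans (map_zero _).symm)
  | succ n =>
    have := h n rfl
    obtain ⟨z, rfl⟩ := Ext.covariant_sequence_exact₁ X hS x hx rfl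
    have hz : z = 0 :=
      Subsingleton.elim (α := Ext X (ModuleCat.of R (M ⧸ y • (⊤ : Submodule R M))) n) z 0
    rw [hz, Ext.zero_comp]
    rfl

/-- If `Ext^i(X, R/p)` vanishes for `i < c`, so does `Ext^i(X, M)` for `M` finitely generated. -/
lemma subsingleton_ext_of_finite [IsNoetherianRing R] {c : ℕ}
    (h : ∀ i < c, Subsingleton (Ext X (ModuleCat.of R (R ⧸ p)) i)) {n : ℕ} (hn : n < c)
    (M : Type u) [AddCommGroup M] [Module R M] [Module.Finite R M] :
    Subsingleton (Ext X (ModuleCat.of R M) n) := by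
  induction n using Nat.strong_induction_on generalizing M with
  | _ n ih =>
  induction ‹Module.Finite R M› using
    IsNoetherianRing.induction_on_isQuotientEquivQuotientPrime R with
  | subsingleton N =>
    have hid : 𝟙 (ModuleCat.of R N) = 0 := by
      ext m
      exact Subsingleton.elim _ _
    refine subsingleton_of_forall_eq 0 fun x ↦ ?_
    rw [← Ext.comp_mk₀_id x, hid, Ext.mk₀_zero, Ext.comp_zero]
  | quotient N q e =>
    by_cases hpq : p ≤ q.asIdeal
    · by_cases hqp : q.asIdeal ≤ p
      · have := h n hn
        obtain rfl : p = q.asIdeal := le_antisymm hpq hqp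
        exact Ext.subsingleton_of_linearEquiv X e.symm n
      · obtain ⟨s, hsq, hsp⟩ := SetLike.not_le_iff_exists.1 hqp
        refine hX.subsingleton_ext_of_forall_smul_eq_zero hsp (fun m ↦ e.injective ?_) n
        obtain ⟨r, hr⟩ := Ideal.Quotient.mk_surjective (e m)
        rw [map_smul, map_zero, ← hr]
        exact Ideal.Quotient.eq_zero_iff_mem.2 (q.asIdeal.mul_mem_right r hsq)
    · obtain ⟨y, hyp, hyq⟩ := SetLike.not_le_iff_exists.1 hpq
      refine hX.subsingleton_ext_of_isSMulRegular hyp ?_ n fun i hi ↦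
        ih i (by lia) (by lia) _
      refine IsSMulRegular.of_right_eq_zero_of_smul fun m hm ↦ e.injective ?_
      obtain ⟨r, hr⟩ := Ideal.Quotient.mk_surjective (e m)
      have hm' : y • e m = 0 := by rw [← map_smul, hm, map_zero]
      rw [← hr] at hm' ⊢
      have hm'' : Ideal.Quotient.mk q.asIdeal (y * r) = 0 := hm'
      rw [map_zero, Ideal.Quotient.eq_zero_iff_mem]
      exact (q.isPrime.mem_or_mem (Ideal.Quotient.eq_zero_iff_mem.1 hm'')).resolve_left hyq
  | exact N₁ N₂ N₃ f g hf hg hfg h₁ h₃ =>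
    exact (ModuleCat.shortComplex_shortExact
      (ModuleCat.shortComplexOfCompEqZero f g hfg.linearMap_comp_eq_zero)
      hfg hf hg).subsingleton_ext_X₂ X n

open LocalizedModule Pointwise in
/-- If `Ext^c(X, R/p)` is nonzero for some `c`, then a finitely generated module supported at `p`
has a nonzero `Ext` group from `X`. -/
lemma exists_nontrivial_ext_of_finite [IsNoetherianRing R] [p.IsPrime] {c : ℕ}
    (hc : Nontrivial (Ext X (ModuleCat.of R (R ⧸ p)) c))
    (M : Type u) [AddCommGroup M] [Module R M] [Module.Finite R M]
    (hM : Module.annihilator R M ≤ p) :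
    ∃ n, Nontrivial (Ext X (ModuleCat.of R M) n) := by
  classical
  by_contra! H
  wlog hmin : ∀ i < c, Subsingleton (Ext X (ModuleCat.of R (R ⧸ p)) i) generalizing c
  · have hex : ∃ i, Nontrivial (Ext X (ModuleCat.of R (R ⧸ p)) i) := ⟨c, hc⟩
    exact this (Nat.find_spec hex) fun i hi ↦
      not_nontrivial_iff_subsingleton.1 (Nat.find_min hex hi)
  induction hI : Module.annihilator R M using WellFoundedGT.induction generalizing M with
  | _ I ih =>
  subst hI
  let L := LinearMap.ker (mkLinearMap p.primeCompl M)
  have hL (m : M) : m ∈ L ↔ ∃ s ∈ p.primeCompl, s • m = 0 := mem_ker_mkLinearMap_iff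
  obtain ⟨t, htL, htp⟩ : ∃ t ∈ Module.annihilator R L, t ∉ p := by
    rw [← SetLike.not_le_iff_exists]
    intro hle
    have := (Module.mem_support_iff_of_finite (p := ⟨p, ‹_›⟩)).2 hle
    rw [Module.mem_support_iff'] at this
    obtain ⟨m, hm⟩ := this
    obtain ⟨s, hs, hsm⟩ := (hL m).1 m.2
    exact hm s hs (Subtype.ext hsm)
  have hLExt (n : ℕ) : Subsingleton (Ext X (ModuleCat.of R L) n) :=
    hX.subsingleton_ext_of_forall_smul_eq_zero htp (Module.mem_annihilator.1 htL) n
  have hQExt (n : ℕ) : Subsingleton (Ext X (ModuleCat.of R (M ⧸ L)) n) := by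
    have hS := ModuleCat.shortComplex_shortExact
      (ModuleCat.shortComplexOfCompEqZero L.subtype L.mkQ
        (LinearMap.exact_subtype_mkQ L).linearMap_comp_eq_zero)
      (LinearMap.exact_subtype_mkQ L) L.injective_subtype L.mkQ_surjective
    have := H n
    exact hS.subsingleton_ext_X₃ X n
  have hMQ : Module.annihilator R M ≤ Module.annihilator R (M ⧸ L) :=
    L.mkQ.annihilator_le_of_surjective L.mkQ_surjective
  have hQp : Module.annihilator R (M ⧸ L) ≤ p := by
    intro r hr
    have : t * r ∈ Module.annihilator R M := by
      refine Module.mem_annihilator.2 fun m ↦ ?_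
      have hrm : r • m ∈ L := by
        rw [← Submodule.Quotient.mk_eq_zero, Submodule.Quotient.mk_smul]
        exact Module.mem_annihilator.1 hr _
      rw [mul_smul]
      exact congrArg Subtype.val (Module.mem_annihilator.1 htL ⟨_, hrm⟩)
    exact (‹p.IsPrime›.mem_or_mem (hM this)).resolve_left htp
  have hQreg {s : R} (hs : s ∉ p) (x : M ⧸ L) (hx : s • x = 0) : x = 0 := by
    obtain ⟨m, rfl⟩ := L.mkQ_surjective x
    rw [← map_smul, Submodule.mkQ_apply, Submodule.Quotient.mk_eq_zero, hL] at hx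
    obtain ⟨r, hr, hrm⟩ := hx
    rw [Submodule.mkQ_apply, Submodule.Quotient.mk_eq_zero, hL]
    exact ⟨r * s, p.primeCompl.mul_mem hr hs, by rw [mul_smul, hrm]⟩
  rcases subsingleton_or_nontrivial ((R ⧸ p) →ₗ[R] M ⧸ L) with hHom | hHom
  · obtain ⟨y, hy, hreg⟩ := IsSMulRegular.subsingleton_linearMap_iff.1 hHom
    rw [Ideal.annihilator_quotient] at hy
    have hsupp : Module.annihilator R ((M ⧸ L) ⧸ y • (⊤ : Submodule R (M ⧸ L))) ≤ p := by
      rw [← Submodule.ideal_span_singleton_smul]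
      refine (Module.mem_support_iff_of_finite (p := ⟨p, ‹_›⟩)).1 ?_
      rw [Module.support_quotient]
      refine ⟨Module.mem_support_iff_of_finite.2 hQp, ?_⟩
      simpa [PrimeSpectrum.mem_zeroLocus] using hy
    refine ih _ ?_ _ hsupp (fun n ↦ ?_) rfl
    · refine lt_of_le_of_ne (hMQ.trans
        (LinearMap.annihilator_le_of_surjective _ (Submodule.mkQ_surjective _))) fun heq ↦ ?_
      have hyM : y ∈ Module.annihilator R M := by
        rw [heq]
        refine Module.mem_annihilator.2 fun x ↦ ?_
        obtain ⟨m, rfl⟩ := Submodule.mkQ_surjective _ x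
        rw [← map_smul, Submodule.mkQ_apply, Submodule.Quotient.mk_eq_zero]
        exact Submodule.smul_mem_pointwise_smul _ _ _ trivial
      have hone : (1 : R) ∈ Module.annihilator R (M ⧸ L) := Module.mem_annihilator.2 fun x ↦ by
        rw [one_smul]
        exact hreg.right_eq_zero_of_smul (Module.mem_annihilator.1 (hMQ hyM) x)
      exact ‹p.IsPrime›.one_notMem (hQp hone)
    · have hS := IsSMulRegular.smulShortComplex_shortExact (M := ModuleCat.of R (M ⧸ L)) hreg
      have : Subsingleton (Ext X (ModuleCat.smulShortComplex (ModuleCat.of R (M ⧸ L)) y).X₁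
        (n + 1)) := hQExt (n + 1)
      have : Subsingleton (Ext X (ModuleCat.smulShortComplex (ModuleCat.of R (M ⧸ L)) y).X₂ n) :=
        hQExt n
      exact hS.subsingleton_ext_X₃ X n
  · obtain ⟨f, hf⟩ := exists_ne (0 : (R ⧸ p) →ₗ[R] M ⧸ L)
    have hinj : Function.Injective f := by
      rw [injective_iff_map_eq_zero]
      intro a ha
      obtain ⟨r, rfl⟩ := Ideal.Quotient.mk_surjective a
      have hmk (r : R) : Ideal.Quotient.mk p r = r • 1 := by
        rw [Algebra.smul_def, mul_one]
        rfl
      rw [Ideal.Quotient.eq_zero_iff_mem]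
      by_contra hr
      rw [hmk, map_smul] at ha
      refine hf (LinearMap.ext fun b ↦ ?_)
      obtain ⟨s, rfl⟩ := Ideal.Quotient.mk_surjective b
      rw [hmk, map_smul, hQreg hr _ ha, smul_zero, LinearMap.zero_apply]
    have hS := ModuleCat.shortComplex_shortExact
      (ModuleCat.shortComplexOfCompEqZero f (LinearMap.range f).mkQ
        (LinearMap.exact_map_mkQ_range f).linearMap_comp_eq_zero)
      (LinearMap.exact_map_mkQ_range f) hinj (Submodule.mkQ_surjective _)
    have := hQExt c
    exact not_subsingleton_iff_nontrivial.2 hc (hS.subsingleton_ext_X₁ X c fun i hi ↦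
      hX.subsingleton_ext_of_finite hmin (by lia) _)

lemma exists_nontrivial_ext_iff [IsNoetherianRing R] [p.IsPrime]
    (M : Type u) [AddCommGroup M] [Module R M] [Module.Finite R M] :
    (∃ n, Nontrivial (Ext X (ModuleCat.of R M) n)) ↔ Module.annihilator R M ≤ p ∧
      ∃ n, Nontrivial (Ext X (ModuleCat.of R (R ⧸ p)) n) := by
  refine ⟨fun ⟨n, hn⟩ ↦ ⟨fun s hs ↦ ?_, ?_⟩, fun ⟨hM, c, hc⟩ ↦
    hX.exists_nontrivial_ext_of_finite hc M hM⟩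
  · by_contra hsp
    exact not_subsingleton_iff_nontrivial.2 hn
      (hX.subsingleton_ext_of_forall_smul_eq_zero hsp (Module.mem_annihilator.1 hs) n)
  · by_contra! H
    exact not_subsingleton_iff_nontrivial.2 hn
      (hX.subsingleton_ext_of_finite (fun i _ ↦ H i) n.lt_succ_self M)

end ActsLikeResidueField
end

/-!
STATEMENT 18: Let `R` be commutative noetherian such that every localization `R_p` has
finite projective dimension as an `R`-module (expressed by the standard
characterization: there is an `n` such that `Ext^i_R(R_p, N)` vanishes for all
`i > n` and all `R`-modules `N`), and let `M` be a finitely generated `R`-module.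
Then the cosupport of `M` equals the intersection of the support of `M`
(the primes `p` with `M_p ≠ 0`) with the cosupport of `R`.
-/
theorem cosupport_fg_module_eq_supp_inter_cosupp (R : Type u) [CommRing R]
    [IsNoetherianRing R]
    (hpd : ∀ p : PrimeSpectrum R, ∃ n : ℕ, ∀ (N : ModuleCat.{u} R) (i : ℕ), n < i →
      Subsingleton (((Ext R (ModuleCat.{u} R) i).obj
        (op (ModuleCat.of R (Localization.AtPrime p.asIdeal)))).obj N))
    (M : Type u) [AddCommGroup M] [Module R M] [Module.Finite R M] :
    ∀ p : PrimeSpectrum R,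
      p ∈ moduleCosupport R M ↔
        (Nontrivial (LocalizedModule p.asIdeal.primeCompl M) ∧
          p ∈ moduleCosupport R R) := by
  intro p
  have hX := ActsLikeResidueField.residueField p
  have hcosupp (N : Type u) [AddCommGroup N] [Module R N] [Module.Finite R N] :
      p ∈ moduleCosupport R N ↔ Module.annihilator R N ≤ p.asIdeal ∧
        ∃ n, Nontrivial (Abelian.Ext (ModuleCat.of R (IsLocalRing.ResidueField
          (Localization.AtPrime p.asIdeal))) (ModuleCat.of R (R ⧸ p.asIdeal)) n) :=
    (exists_congr fun n ↦ nontrivial_ext_iff _ _ n).trans (hX.exists_nontrivial_ext_iff N)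
  have hR : Module.annihilator R R ≤ p.asIdeal := fun r hr ↦ by
    have h := Module.mem_annihilator.1 hr 1
    rw [smul_eq_mul, mul_one] at h
    exact h ▸ p.asIdeal.zero_mem
  rw [hcosupp, hcosupp, and_iff_right hR, ← Module.mem_support_iff_of_finite,
    Module.mem_support_iff]
end
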